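/- Let C ∈ (ℝ²)*⊗(ℝ²)*⊗ℝ² with det ρ_{s,C} ≠ 0. Then ∇^C is not of Type A: there exist no nonempty connected open set U ⊆ ℝ², no smooth map Φ = (Φ¹,Φ²) : U → ℝ⁺×ℝ with everywhere invertible differential, and no real constants A_{ij}{}^k (i,j,k ∈ {1,2}) such that for all x ∈ U and all i,j,m ∈ {1,2}: ∂_{x^i}∂_{x^j}Φ^m + (Φ¹(x))⁻¹ Σ_{p,q} C_{pq}{}^m ∂_{x^i}Φ^p ∂_{x^j}Φ^q = Σ_l A_{ij}{}^l ∂_{x^l}Φ^m. (This equation says exactly that the pullback connection Φ*∇^C has constant Christoffel symbols A_{ij}{}^k, i.e. is a Type A structure.) -/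

import Mathlib

open scoped BigOperators
open Matrix

/-- The Ricci matrix `ρ_C` of the Type B connection with Christoffel symbols
`Γ_{ij}{}^k = C_{ij}{}^k/x¹` (evaluated at `x¹ = 1`; indices are 0-based, so
`C 0 0 0 = C₁₁¹`, etc.). -/
noncomputable def rhoC (C : Fin 2 → Fin 2 → Fin 2 → ℝ) : Matrix (Fin 2) (Fin 2) ℝ :=
  !![(C 0 0 0 - C 0 1 1 + 1) * C 1 0 1 + C 0 0 1 * (C 1 1 1 - C 1 0 0),
     C 1 1 1 + C 0 1 0 * C 1 0 1 - C 0 0 1 * C 1 1 0;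
     -C 1 0 0 + C 0 1 0 * C 1 0 1 - C 0 0 1 * C 1 1 0,
     (C 0 0 0 - C 0 1 1 - 1) * C 1 1 0 + C 0 1 0 * (C 1 1 1 - C 1 0 0)]

/-- The symmetric Ricci matrix `ρ_{s,C} = (ρ_C + ρ_Cᵀ)/2`. -/
noncomputable def rhoS (C : Fin 2 → Fin 2 → Fin 2 → ℝ) : Matrix (Fin 2) (Fin 2) ℝ :=
  (1 / 2 : ℝ) • (rhoC C + (rhoC C)ᵀ)
/-- The partial derivative `∂_{x^i} f` of a function on `ℝ²`. -/
noncomputable def pd (i : Fin 2) (f : ℝ × ℝ → ℝ) : ℝ × ℝ → ℝ :=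
  fun p => fderiv ℝ f p (if i = 0 then (1, 0) else (0, 1))

/-- The Christoffel symbols `Γ_{ij}{}^k = C_{ij}{}^k/x¹` of the Type B connection `∇^C`. -/
noncomputable def Gam (C : Fin 2 → Fin 2 → Fin 2 → ℝ) (i j k : Fin 2) : ℝ × ℝ → ℝ :=
  fun p => C i j k / p.1

/-- The affine Killing equation for a vector field `X = X¹∂₁ + X²∂₂` (components
`fun p => X p l`) with respect to the Type B connection `∇^C`, at the point `p`:
`∂_i∂_j X^l + Σ_k (X^k ∂_k Γ_{ij}{}^l + Γ_{kj}{}^l ∂_i X^k + Γ_{ik}{}^l ∂_j X^k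
  − Γ_{ij}{}^k ∂_k X^l) = 0` for all `i j l`. -/
noncomputable def IsAffineKillingAt (C : Fin 2 → Fin 2 → Fin 2 → ℝ)
    (X : ℝ × ℝ → Fin 2 → ℝ) (p : ℝ × ℝ) : Prop :=
  ∀ i j l : Fin 2,
    pd i (pd j fun q => X q l) p
      + ∑ k : Fin 2,
          (X p k * pd k (Gam C i j l) p
            + Gam C k j l p * pd i (fun q => X q k) p
            + Gam C i k l p * pd j (fun q => X q k) p
            - Gam C i j k p * pd k (fun q => X q l) p) = 0

/-- The `m`-th component function of a map `Φ : ℝ² → ℝ²`. -/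
noncomputable def comp2 (m : Fin 2) (Φ : ℝ × ℝ → ℝ × ℝ) : ℝ × ℝ → ℝ :=
  fun x => if m = 0 then (Φ x).1 else (Φ x).2

/-- The derivative `∂_k e_i^m` of the coframe `e_i^m = ∂_iΦ^m/Φ¹` prescribed by the equation
`∂_i∂_jΦ^m + (Φ¹)⁻¹ C(∂_iΦ, ∂_jΦ)^m = Σ_l A_{ij}{}^l ∂_lΦ^m`. -/
noncomputable def coframeDeriv (C A : Fin 2 → Fin 2 → Fin 2 → ℝ) (E : Fin 2 → Fin 2 → ℝ)
    (k i m : Fin 2) : ℝ :=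
  ∑ l, A k i l * E l m - (∑ p, ∑ q, C p q m * (E k p * E i q) + E k 0 * E i m)

/-- The derivative of `coframeDeriv C A E i j m` in the direction `E'` of coframe variations. -/
noncomputable def coframeDerivLin (C A : Fin 2 → Fin 2 → Fin 2 → ℝ) (E E' : Fin 2 → Fin 2 → ℝ)
    (i j m : Fin 2) : ℝ :=
  ∑ l, A i j l * E' l m -
    (∑ p, ∑ q, C p q m * (E' i p * E j q + E i p * E' j q) + (E' i 0 * E j m + E i 0 * E' j m))

/-- The Ricci tensor of the Type A connection with Christoffel symbols `A`. -/
noncomputable def ricciA (A : Fin 2 → Fin 2 → Fin 2 → ℝ) : Matrix (Fin 2) (Fin 2) ℝ :=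
  Matrix.of fun i j => if i = 0 then ∑ l, (A 0 j l * A 1 l 1 - A 1 j l * A 0 l 1)
    else ∑ l, (A 1 j l * A 0 l 0 - A 0 j l * A 1 l 0)

/-- The integrability condition of the coframe equation: the curvatures of the Type A structure and
of `∇^C` agree, each expressed through its Ricci tensor. -/
theorem curvature_pullback {C A : Fin 2 → Fin 2 → Fin 2 → ℝ} {E : Fin 2 → Fin 2 → ℝ}
    (j m : Fin 2)
    (ht : ∀ p, ∑ l, (A 0 1 l - A 1 0 l) * E l p =
      ∑ a, ∑ b, C a b p * (E 0 a * E 1 b - E 1 a * E 0 b))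
    (hI : coframeDerivLin C A E (coframeDeriv C A E 0) 1 j m =
      coframeDerivLin C A E (coframeDeriv C A E 1) 0 j m) :
    ricciA A 1 j * E 0 m - ricciA A 0 j * E 1 m =
      (E 0 0 * E 1 1 - E 0 1 * E 1 0) *
        ∑ n, (if m = 0 then rhoC C 1 n else - rhoC C 0 n) * E j n := by
  have t0 := ht 0
  have t1 := ht 1
  have hr0 : ∑ n, rhoC C 0 n * E j n = ((C 0 0 0 - C 0 1 1 + 1) * C 1 0 1
      + C 0 0 1 * (C 1 1 1 - C 1 0 0)) * E j 0
      + (C 1 1 1 + C 0 1 0 * C 1 0 1 - C 0 0 1 * C 1 1 0) * E j 1 := by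
    simp [rhoC, Fin.sum_univ_two]
  have hr1 : ∑ n, rhoC C 1 n * E j n = (-C 1 0 0 + C 0 1 0 * C 1 0 1 - C 0 0 1 * C 1 1 0) * E j 0
      + ((C 0 0 0 - C 0 1 1 - 1) * C 1 1 0 + C 0 1 0 * (C 1 1 1 - C 1 0 0)) * E j 1 := by
    simp [rhoC, Fin.sum_univ_two]
  fin_cases m <;>
    simp only [Fin.zero_eta, Fin.mk_one, if_true, one_ne_zero, if_false, neg_mul,
      Finset.sum_neg_distrib, hr0, hr1] at hI ⊢ <;>
    simp only [coframeDerivLin, coframeDeriv, ricciA, Fin.sum_univ_two, Matrix.of_apply, if_true,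
      one_ne_zero, if_false] at hI t0 t1 ⊢
  · linear_combination hI + t0 * (C 0 0 0 * E j 0 + C 0 1 0 * E j 1 + E j 0)
      + t1 * (C 1 0 0 * E j 0 + C 1 1 0 * E j 1)
  · linear_combination hI + t0 * (C 0 0 1 * E j 0 + C 0 1 1 * E j 1 + E j 1)
      + t1 * (C 1 0 1 * E j 0 + C 1 1 1 * E j 1)

theorem ricci_pullback {C A : Fin 2 → Fin 2 → Fin 2 → ℝ} {E : Fin 2 → Fin 2 → ℝ}
    (hE : E 0 0 * E 1 1 - E 0 1 * E 1 0 ≠ 0)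
    (ht : ∀ p, ∑ l, (A 0 1 l - A 1 0 l) * E l p =
      ∑ a, ∑ b, C a b p * (E 0 a * E 1 b - E 1 a * E 0 b))
    (hI : ∀ j m, coframeDerivLin C A E (coframeDeriv C A E 0) 1 j m =
      coframeDerivLin C A E (coframeDeriv C A E 1) 0 j m) (i j : Fin 2) :
    ∑ m, ∑ n, rhoC C m n * (E i m * E j n) = ricciA A i j := by
  have h0 := curvature_pullback j 0 ht (hI j 0)
  have h1 := curvature_pullback j 1 ht (hI j 1)
  simp only [Fin.sum_univ_two, if_true, one_ne_zero, if_false] at h0 h1 ⊢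
  apply mul_left_cancel₀ hE
  fin_cases i
  · simp only [Fin.zero_eta]
    linear_combination E 0 0 * h1 - E 0 1 * h0
  · simp only [Fin.mk_one]
    linear_combination E 1 0 * h1 - E 1 1 * h0

/-- A trilinear form on a plane annihilated by a trace-free invertible endomorphism vanishes. -/
theorem trilinear_eq_zero_of_traceless {T : Fin 2 → Fin 2 → ℝ} {h : Fin 2 → Fin 2 → Fin 2 → ℝ}
    (htr : T 0 0 + T 1 1 = 0) (hdet : T 0 0 * T 1 1 - T 0 1 * T 1 0 ≠ 0)
    (hT : ∀ i j l, ∑ a, (T i a * h a j l + T j a * h i a l + T l a * h i j a) = 0) (i j l : Fin 2) :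
    h i j l = 0 := by
  set D := T 0 0 * T 1 1 - T 0 1 * T 1 0 with hD
  have h11 : T 1 1 = - T 0 0 := by linarith
  have sq : ∀ (i : Fin 2) (f : Fin 2 → ℝ), ∑ a, T i a * ∑ b, T a b * f b = - D * f i := by
    intro i f
    fin_cases i <;> simp [Fin.sum_univ_two, hD, h11] <;> ring
  have e1 : ∀ i j l, 2 * ∑ a, ∑ b, T i a * T j b * h a b l = D * h i j l := by
    intro i j l
    have s1 := sq i fun a => h a j l
    have s2 := sq j fun a => h i a l
    have s3 := sq l fun a => h i j a
    have k1 := fun a => hT a j l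
    have k2 := fun a => hT i a l
    have k3 := fun a => hT i j a
    simp only [Fin.sum_univ_two] at *
    linear_combination T i 0 * k1 0 + T i 1 * k1 1 + T j 0 * k2 0 + T j 1 * k2 1
      - T l 0 * k3 0 - T l 1 * k3 1 - s1 - s2 + s3
  have e2 : 3 * D ^ 2 * h i j l = 0 := by
    have s0 := fun b => sq i fun a => h a b l
    have s1 := sq j fun b => h i b l
    have k := fun a b => e1 a b l
    simp only [Fin.sum_univ_two] at *
    linear_combination D * k i j + 2 * (T i 0 * T j 0 * k 0 0 + T i 0 * T j 1 * k 0 1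
      + T i 1 * T j 0 * k 1 0 + T i 1 * T j 1 * k 1 1)
      - 4 * (T j 0 * (T 0 0 * s0 0 + T 0 1 * s0 1) + T j 1 * (T 1 0 * s0 0 + T 1 1 * s0 1))
      + 4 * D * s1
  simpa [hdet] using e2

/-- Koszul: a torsion-free metric-compatible constant connection on a nondegenerate plane is zero. -/
theorem symbols_eq_zero {A : Fin 2 → Fin 2 → Fin 2 → ℝ} {R : Matrix (Fin 2) (Fin 2) ℝ}
    (hR : R.det ≠ 0)
    (hm : ∀ k i j, ∑ l, (A k i l * R l j + A k j l * R l i) = 0)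
    (ht : ∀ k i j, ∑ l, (A k i l - A i k l) * R l j = 0) : A = 0 := by
  have low : ∀ k i j, ∑ l, A k i l * R l j = 0 := by
    intro k i j
    have a1 := hm k i j
    have a2 := hm i k j
    have a3 := hm j k i
    have b1 := ht k i j
    have b2 := ht k j i
    have b3 := ht i j k
    simp only [Fin.sum_univ_two] at *
    linarith
  funext k i
  have h0 := low k i 0
  have h1 := low k i 1
  rw [Matrix.det_fin_two] at hR
  simp only [Fin.sum_univ_two] at h0 h1
  funext l
  apply mul_left_cancel₀ hR
  fin_cases l
  · simp only [Fin.zero_eta, Pi.zero_apply, mul_zero]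
    linear_combination R 1 1 * h0 - R 1 0 * h1
  · simp only [Fin.mk_one, Pi.zero_apply, mul_zero]
    linear_combination R 0 0 * h1 - R 0 1 * h0

/-- An endomorphism skew for a nondegenerate symmetric form on a plane is trace-free, and is zero
unless it is invertible. -/
theorem skew_endomorphism {T : Fin 2 → Fin 2 → ℝ} {R : Matrix (Fin 2) (Fin 2) ℝ}
    (hR : R.det ≠ 0) (hs : R 0 1 = R 1 0)
    (hT : ∀ i j, ∑ a, (T i a * R a j + T j a * R a i) = 0) :
    T 0 0 + T 1 1 = 0 ∧ (T 0 0 * T 1 1 - T 0 1 * T 1 0 = 0 → T = 0) := by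
  have h00 := hT 0 0
  have h01 := hT 0 1
  have h11 := hT 1 1
  rw [Matrix.det_fin_two] at hR
  simp only [Fin.sum_univ_two] at h00 h01 h11
  refine ⟨?_, fun hd => ?_⟩
  · apply mul_left_cancel₀ hR
    rw [hs] at *
    linear_combination R 1 1 / 2 * h00 + R 0 0 / 2 * h11 - R 1 0 * h01
  · have hx : T 0 0 * R 0 1 + T 0 1 * R 1 1 = 0 := by
      rw [← sq_eq_zero_iff]
      linear_combination (R 0 0 * R 1 1 - R 0 1 * R 1 0) * hd
        + (T 0 0 * R 0 1 + T 0 1 * R 1 1) * h01 - (T 1 0 * R 0 1 + T 1 1 * R 1 1) / 2 * h00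
    funext i j
    apply mul_left_cancel₀ hR
    fin_cases i <;> fin_cases j <;>
      simp only [Fin.zero_eta, Fin.mk_one, Pi.zero_apply, mul_zero]
    · linear_combination R 1 1 / 2 * h00 - R 1 0 * hx
    · linear_combination R 0 0 * hx - R 0 1 / 2 * h00
    · linear_combination R 1 1 * (h01 - hx) - R 1 0 / 2 * h11
    · linear_combination R 0 0 / 2 * h11 - R 0 1 * (h01 - hx)

/-- Constancy of the pullback `R` of a symmetric form `S` by the coframe determines the pullback of
a cubic tensor built from `C` and `S` in terms of `A` and `R`. -/
theorem metric_derivative_pullback {C A : Fin 2 → Fin 2 → Fin 2 → ℝ} {E : Fin 2 → Fin 2 → ℝ}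
    {S R : Matrix (Fin 2) (Fin 2) ℝ} (hS : S 0 1 = S 1 0)
    (hR : ∀ i j, ∑ m, ∑ n, S m n * (E i m * E j n) = R i j) (k i j : Fin 2)
    (h : ∑ m, ∑ n, S m n * (coframeDeriv C A E k i m * E j n + E i m * coframeDeriv C A E k j n)
      = 0) :
    ∑ p, ∑ q, ∑ r, (∑ m, ((C p q m + if p = 0 ∧ q = m then 1 else 0) * S m r
        + (C p r m + if p = 0 ∧ r = m then 1 else 0) * S m q)) * (E k p * E i q * E j r)
      = ∑ l, (A k i l * R l j + A k j l * R l i) := by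
  simp only [← hR]
  simp [coframeDeriv, Fin.sum_univ_two, hS] at h ⊢
  linear_combination - h

theorem torsion_pullback {C A : Fin 2 → Fin 2 → Fin 2 → ℝ} {E : Fin 2 → Fin 2 → ℝ}
    {S R : Matrix (Fin 2) (Fin 2) ℝ}
    (hR : ∀ i j, ∑ m, ∑ n, S m n * (E i m * E j n) = R i j) (k i j : Fin 2)
    (ht : ∀ p, ∑ l, (A k i l - A i k l) * E l p =
      ∑ a, ∑ b, C a b p * (E k a * E i b - E i a * E k b)) :
    ∑ p, ∑ q, ∑ r, (∑ m, (C p q m - C q p m) * S m r) * (E k p * E i q * E j r)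
      = ∑ l, (A k i l - A i k l) * R l j := by
  have t0 := ht 0
  have t1 := ht 1
  simp only [← hR]
  simp only [Fin.sum_univ_two] at t0 t1 ⊢
  linear_combination - t0 * (S 0 0 * E j 0 + S 0 1 * E j 1) - t1 * (S 1 0 * E j 0 + S 1 1 * E j 1)

theorem exists_coframe_components {E : Fin 2 → Fin 2 → ℝ}
    (hE : E 0 0 * E 1 1 - E 0 1 * E 1 0 ≠ 0) (E' : Fin 2 → Fin 2 → ℝ) :
    ∃ T : Fin 2 → Fin 2 → ℝ, ∀ i m, E' i m = ∑ a, T i a * E a m := by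
  refine ⟨fun i a => if a = 0 then (E' i 0 * E 1 1 - E' i 1 * E 1 0) /
      (E 0 0 * E 1 1 - E 0 1 * E 1 0)
    else (E' i 1 * E 0 0 - E' i 0 * E 0 1) / (E 0 0 * E 1 1 - E 0 1 * E 1 0), fun i m => ?_⟩
  simp only [Fin.sum_univ_two, if_true, one_ne_zero, if_false]
  rw [div_mul_eq_mul_div, div_mul_eq_mul_div, ← add_div, eq_div_iff hE]
  obtain rfl | rfl : m = 0 ∨ m = 1 := by omega
  · ring
  · ring

/-- `f` is differentiable at `x` and its `k`-th partial derivative there is `f'`, as a real number. -/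
def HasPD (k : Fin 2) (f : ℝ × ℝ → ℝ) (f' : ℝ) (x : ℝ × ℝ) : Prop :=
  DifferentiableAt ℝ f x ∧ pd k f x = f'

namespace HasPD

variable {k : Fin 2} {f g : ℝ × ℝ → ℝ} {f' g' c : ℝ} {x : ℝ × ℝ}

theorem add (hf : HasPD k f f' x) (hg : HasPD k g g' x) :
    HasPD k (fun y => f y + g y) (f' + g') x :=
  ⟨hf.1.add hg.1, by simp only [pd, fderiv_fun_add hf.1 hg.1, ← hf.2, ← hg.2]; rfl⟩

theorem sub (hf : HasPD k f f' x) (hg : HasPD k g g' x) :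
    HasPD k (fun y => f y - g y) (f' - g') x :=
  ⟨hf.1.sub hg.1, by simp only [pd, fderiv_fun_sub hf.1 hg.1, ← hf.2, ← hg.2]; rfl⟩

theorem mul (hf : HasPD k f f' x) (hg : HasPD k g g' x) :
    HasPD k (fun y => f y * g y) (f' * g x + f x * g') x := by
  refine ⟨hf.1.mul hg.1, ?_⟩
  simp only [pd, fderiv_fun_mul hf.1 hg.1, ← hf.2, ← hg.2, _root_.add_apply,
    _root_.smul_apply, smul_eq_mul]
  ring

theorem const_mul (c : ℝ) (hf : HasPD k f f' x) : HasPD k (fun y => c * f y) (c * f') x :=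
  ⟨hf.1.const_mul c, by simp [pd, fderiv_const_mul hf.1, ← hf.2]⟩

theorem sum {h : Fin 2 → ℝ × ℝ → ℝ} {h' : Fin 2 → ℝ} (hh : ∀ i, HasPD k (h i) (h' i) x) :
    HasPD k (fun y => ∑ i, h i y) (∑ i, h' i) x := by
  simp only [Fin.sum_univ_two]
  exact (hh 0).add (hh 1)

theorem div (hf : HasPD k f f' x) (hg : HasPD k g g' x) (h0 : g x ≠ 0) :
    HasPD k (fun y => f y / g y) ((f' * g x - f x * g') / g x ^ 2) x := by
  have hd : DifferentiableAt ℝ (fun y => f y / g y) x := by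
    simp only [div_eq_mul_inv]
    exact hf.1.mul (hg.1.inv h0)
  refine ⟨hd, ?_⟩
  have hq : HasPD k (fun y => f y / g y) (pd k (fun y => f y / g y) x) x := ⟨hd, rfl⟩
  have hm := hq.mul hg
  have hev : (fun y => f y / g y * g y) =ᶠ[nhds x] f := by
    filter_upwards [hg.1.continuousAt.eventually_ne h0] with y hy
    exact div_mul_cancel₀ _ hy
  have h1 : f' = pd k (fun y => f y / g y) x * g x + f x / g x * g' := by
    rw [← hm.2, ← hf.2, pd, pd, hev.fderiv_eq]
  rw [eq_div_iff (pow_ne_zero 2 h0), h1]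
  field_simp
  ring

theorem eq_of_eventuallyEq (hf : HasPD k f f' x) (hg : HasPD k g g' x) (h : f =ᶠ[nhds x] g) :
    f' = g' := by
  rw [← hf.2, ← hg.2, pd, pd, h.fderiv_eq]

theorem eq_zero_of_eventually_const (hf : HasPD k f f' x) (h : ∀ᶠ y in nhds x, f y = c) :
    f' = 0 :=
  hf.eq_of_eventuallyEq (g := fun _ => c) ⟨differentiableAt_const c, by simp [pd]⟩ h

theorem of_contDiffAt (hf : ContDiffAt ℝ (⊤ : ℕ∞) f x) : HasPD k f (pd k f x) x :=
  ⟨hf.differentiableAt (by simp), rfl⟩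

end HasPD

theorem ContDiffAt.pd {k : Fin 2} {f : ℝ × ℝ → ℝ} {x : ℝ × ℝ} (hf : ContDiffAt ℝ (⊤ : ℕ∞) f x) :
    ContDiffAt ℝ (⊤ : ℕ∞) (pd k f) x :=
  (hf.fderiv_right (m := (⊤ : ℕ∞)) (by simp)).clm_apply contDiffAt_const

theorem pd_comm {f : ℝ × ℝ → ℝ} {x : ℝ × ℝ} (hf : ContDiffAt ℝ (⊤ : ℕ∞) f x) (k i : Fin 2) :
    pd k (pd i f) x = pd i (pd k f) x := by
  have hd : DifferentiableAt ℝ (fderiv ℝ f) x :=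
    (hf.fderiv_right (m := (⊤ : ℕ∞)) (by simp)).differentiableAt (by simp)
  have h : ∀ v w : ℝ × ℝ, fderiv ℝ (fun p => fderiv ℝ f p v) x w =
      fderiv ℝ (fderiv ℝ f) x w v := by
    intro v w
    rw [fderiv_clm_apply hd (differentiableAt_const v)]
    simp
  have hs := (hf.isSymmSndFDerivAt (by simpa using WithTop.coe_le_coe.2 (le_top : (2 : ℕ∞) ≤ ⊤))).eq
  change fderiv ℝ (fun p => fderiv ℝ f p _) x _ = fderiv ℝ (fun p => fderiv ℝ f p _) x _
  rw [h, h]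
  exact hs _ _

theorem hasPD_coframeDeriv (C A : Fin 2 → Fin 2 → Fin 2 → ℝ) {e : Fin 2 → Fin 2 → ℝ × ℝ → ℝ}
    {E' : Fin 2 → Fin 2 → ℝ} {k : Fin 2} {x : ℝ × ℝ} (he : ∀ i m, HasPD k (e i m) (E' i m) x)
    (i j m : Fin 2) :
    HasPD k (fun y => coframeDeriv C A (fun i m => e i m y) i j m)
      (coframeDerivLin C A (fun i m => e i m x) E' i j m) x :=
  (HasPD.sum fun l => (he l m).const_mul _).sub
    ((HasPD.sum fun p => HasPD.sum fun q => ((he i p).mul (he j q)).const_mul _).add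
      ((he i 0).mul (he j m)))

theorem hasPD_bilinear_pullback (S : Matrix (Fin 2) (Fin 2) ℝ) {e : Fin 2 → Fin 2 → ℝ × ℝ → ℝ}
    {E' : Fin 2 → Fin 2 → ℝ} {k : Fin 2} {x : ℝ × ℝ} (he : ∀ i m, HasPD k (e i m) (E' i m) x)
    (i j : Fin 2) :
    HasPD k (fun y => ∑ m, ∑ n, S m n * (e i m y * e j n y))
      (∑ m, ∑ n, S m n * (E' i m * e j n x + e i m x * E' j n)) x :=
  HasPD.sum fun m => HasPD.sum fun n => ((he i m).mul (he j n)).const_mul _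

/-- If a cubic tensor has constant pullback by a coframe whose derivative in some direction is a
trace-free invertible endomorphism of the coframe, then the pullback vanishes. -/
theorem trilinear_pullback_eq_zero {H h : Fin 2 → Fin 2 → Fin 2 → ℝ}
    {e : Fin 2 → Fin 2 → ℝ × ℝ → ℝ} {T : Fin 2 → Fin 2 → ℝ} {k : Fin 2} {x : ℝ × ℝ}
    (he : ∀ i m, HasPD k (e i m) (∑ a, T i a * e a m x) x)
    (htr : T 0 0 + T 1 1 = 0) (hdet : T 0 0 * T 1 1 - T 0 1 * T 1 0 ≠ 0)
    (hH : ∀ᶠ y in nhds x, ∀ i j l,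
      ∑ p, ∑ q, ∑ r, H p q r * (e i p y * e j q y * e l r y) = h i j l) (i j l : Fin 2) :
    h i j l = 0 := by
  refine trilinear_eq_zero_of_traceless htr hdet (fun i j l => ?_) i j l
  have hd := (HasPD.sum fun p => HasPD.sum fun q => HasPD.sum fun r =>
    (((he i p).mul (he j q)).mul (he l r)).const_mul (H p q r)).eq_zero_of_eventually_const
      (hH.mono fun y hy => hy i j l)
  simp only [← hH.self_of_nhds]
  rw [← hd]
  simp only [Fin.sum_univ_two]
  ring

theorem rhoS_pullback {C A : Fin 2 → Fin 2 → Fin 2 → ℝ} {E : Fin 2 → Fin 2 → ℝ}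
    (h : ∀ i j, ∑ m, ∑ n, rhoC C m n * (E i m * E j n) = ricciA A i j) (i j : Fin 2) :
    ∑ m, ∑ n, rhoS C m n * (E i m * E j n) = (ricciA A i j + ricciA A j i) / 2 := by
  simp only [← h, rhoS, Matrix.smul_apply, Matrix.add_apply, Matrix.transpose_apply, smul_eq_mul,
    Fin.sum_univ_two]
  ring

/-- There is no coframe on an open set which satisfies the structure equations obtained from an
identification of `∇^C` with a Type A structure. -/
theorem no_type_A_coframe {C A : Fin 2 → Fin 2 → Fin 2 → ℝ} (hdet : (rhoS C).det ≠ 0)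
    {U : Set (ℝ × ℝ)} (hU : IsOpen U) {x : ℝ × ℝ} (hx : x ∈ U)
    {e : Fin 2 → Fin 2 → ℝ × ℝ → ℝ} (hsm : ∀ y ∈ U, ∀ i m, ContDiffAt ℝ (⊤ : ℕ∞) (e i m) y)
    (hE : ∀ y ∈ U, e 0 0 y * e 1 1 y - e 0 1 y * e 1 0 y ≠ 0)
    (he : ∀ y ∈ U, ∀ k i m, pd k (e i m) y = coframeDeriv C A (fun i m => e i m y) k i m)
    (ht : ∀ y ∈ U, ∀ k i p, ∑ l, (A k i l - A i k l) * e l p y =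
      ∑ a, ∑ b, C a b p * (e k a y * e i b y - e i a y * e k b y)) : False := by
  have hpd : ∀ y ∈ U, ∀ k i m,
      HasPD k (e i m) (coframeDeriv C A (fun i m => e i m y) k i m) y := fun y hy k i m =>
    ⟨(HasPD.of_contDiffAt (k := k) (hsm y hy i m)).1, he y hy k i m⟩
  have hI : ∀ y ∈ U, ∀ k i j m,
      coframeDerivLin C A (fun i m => e i m y) (coframeDeriv C A (fun i m => e i m y) k) i j m
        = pd k (pd i (e j m)) y := by
    intro y hy k i j m
    refine (hasPD_coframeDeriv C A (hpd y hy k) i j m).eq_of_eventuallyEq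
      (.of_contDiffAt (hsm y hy j m).pd) ?_
    filter_upwards [hU.mem_nhds hy] with z hz
    exact (he z hz i j m).symm
  set R : Matrix (Fin 2) (Fin 2) ℝ := Matrix.of fun i j => (ricciA A i j + ricciA A j i) / 2
    with hRdef
  have hR : ∀ y ∈ U, ∀ i j, ∑ m, ∑ n, rhoS C m n * (e i m y * e j n y) = R i j := by
    intro y hy
    refine rhoS_pullback (E := fun i m => e i m y) (ricci_pullback (hE y hy) (ht y hy 0 1) ?_)
    intro j m
    rw [hI y hy, hI y hy, pd_comm (hsm y hy j m)]
  have hSs : rhoS C 0 1 = rhoS C 1 0 := by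
    simp [rhoS, add_comm]
  have hRs : R 0 1 = R 1 0 := by
    simp [hRdef, add_comm]
  have hRdet : R.det ≠ 0 := by
    have h : R.det = (e 0 0 x * e 1 1 x - e 0 1 x * e 1 0 x) ^ 2 * (rhoS C).det := by
      simp only [Matrix.det_fin_two, ← hR x hx, Fin.sum_univ_two]
      ring
    rw [h]
    exact mul_ne_zero (pow_ne_zero 2 (hE x hx)) hdet
  have hmet : ∀ y ∈ U, ∀ k i j, ∑ m, ∑ n, rhoS C m n *
      (coframeDeriv C A (fun i m => e i m y) k i m * e j n y
        + e i m y * coframeDeriv C A (fun i m => e i m y) k j n) = 0 := fun y hy k i j =>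
    (hasPD_bilinear_pullback (rhoS C) (hpd y hy k) i j).eq_zero_of_eventually_const
      (by filter_upwards [hU.mem_nhds hy] with z hz using hR z hz i j)
  choose T hT using fun k => exists_coframe_components (E := fun i m => e i m x) (hE x hx)
    (coframeDeriv C A (fun i m => e i m x) k)
  have hskew : ∀ k i j, ∑ a, (T k i a * R a j + T k j a * R a i) = 0 := by
    intro k i j
    rw [← hmet x hx k i j]
    simp only [← hR x hx, hT, Fin.sum_univ_two, hSs]
    ring
  obtain ⟨k, hk⟩ : ∃ k, T k ≠ 0 := by
    by_contra! h
    have h0 := hT 0 1 1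
    have h1 := hT 1 0 1
    have htor := ht x hx 0 1 1
    simp only [h, coframeDeriv, Fin.sum_univ_two, Pi.zero_apply, zero_mul, add_zero]
      at h0 h1 htor
    exact hE x hx (by linear_combination htor - h0 + h1)
  obtain ⟨htr, hinv⟩ := skew_endomorphism hRdet hRs (hskew k)
  have hTdet := mt hinv hk
  have hpdT : ∀ i m, HasPD k (e i m) (∑ a, T k i a * e a m x) x := fun i m =>
    hT k i m ▸ hpd x hx k i m
  have hA : A = 0 := by
    refine symbols_eq_zero hRdet ?_ ?_
    · refine trilinear_pullback_eq_zero (H := fun p q r =>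
        ∑ m, ((C p q m + if p = 0 ∧ q = m then 1 else 0) * rhoS C m r
          + (C p r m + if p = 0 ∧ r = m then 1 else 0) * rhoS C m q)) hpdT htr hTdet ?_
      filter_upwards [hU.mem_nhds hx] with y hy k i j
      exact metric_derivative_pullback hSs (hR y hy) k i j (hmet y hy k i j)
    · refine trilinear_pullback_eq_zero (H := fun p q r =>
        ∑ m, (C p q m - C q p m) * rhoS C m r) hpdT htr hTdet ?_
      filter_upwards [hU.mem_nhds hx] with y hy k i j
      exact torsion_pullback (hR y hy) k i j (ht y hy k i)
  apply hRdet
  simp [hRdef, hA, ricciA, Matrix.det_fin_two]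

theorem ContDiffAt.comp2 {Φ : ℝ × ℝ → ℝ × ℝ} {x : ℝ × ℝ} (h : ContDiffAt ℝ (⊤ : ℕ∞) Φ x)
    (m : Fin 2) : ContDiffAt ℝ (⊤ : ℕ∞) (comp2 m Φ) x := by
  obtain rfl | rfl : m = 0 ∨ m = 1 := by omega
  · exact h.fst
  · exact h.snd

theorem det_fderiv_eq {Φ : ℝ × ℝ → ℝ × ℝ} {x : ℝ × ℝ} (h : DifferentiableAt ℝ Φ x) :
    LinearMap.det (fderiv ℝ Φ x : ℝ × ℝ →ₗ[ℝ] ℝ × ℝ) =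
      pd 0 (comp2 0 Φ) x * pd 1 (comp2 1 Φ) x - pd 0 (comp2 1 Φ) x * pd 1 (comp2 0 Φ) x := by
  have h0 : fderiv ℝ (comp2 0 Φ) x = (ContinuousLinearMap.fst ℝ ℝ ℝ).comp (fderiv ℝ Φ x) :=
    h.hasFDerivAt.fst.fderiv
  have h1 : fderiv ℝ (comp2 1 Φ) x = (ContinuousLinearMap.snd ℝ ℝ ℝ).comp (fderiv ℝ Φ x) :=
    h.hasFDerivAt.snd.fderiv
  rw [← LinearMap.det_toMatrix (Module.Basis.finTwoProd ℝ), Matrix.det_fin_two]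
  simp [pd, h0, h1, LinearMap.toMatrix_apply]
  ring

/-- If `det ρ_{s,C} ≠ 0` then `∇^C` is not of Type A: there is no smooth local
diffeomorphism `Φ` into the half-plane, defined on a nonempty connected open set,
such that the pullback connection `Φ*∇^C` has constant Christoffel symbols
`A_{ij}{}^k`.  The displayed equation
`∂_i∂_j Φ^m + (Φ¹)⁻¹ Σ_{p,q} C_{pq}{}^m ∂_iΦ^p ∂_jΦ^q = Σ_l A_{ij}{}^l ∂_lΦ^m`
says exactly that `Φ*∇^C` is the Type A structure with symbols `A`. -/
theorem not_type_A (C : Fin 2 → Fin 2 → Fin 2 → ℝ) (hdet : (rhoS C).det ≠ 0) :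
    ¬ ∃ (U : Set (ℝ × ℝ)) (Φ : ℝ × ℝ → ℝ × ℝ) (A : Fin 2 → Fin 2 → Fin 2 → ℝ),
        U.Nonempty ∧ IsOpen U ∧ IsConnected U ∧ ContDiffOn ℝ (⊤ : ℕ∞) Φ U ∧
        (∀ x ∈ U, 0 < (Φ x).1) ∧
        (∀ x ∈ U, LinearMap.det (fderiv ℝ Φ x : ℝ × ℝ →ₗ[ℝ] ℝ × ℝ) ≠ 0) ∧
        (∀ x ∈ U, ∀ i j m : Fin 2,
          pd i (pd j (comp2 m Φ)) x
            + ((Φ x).1)⁻¹ * ∑ p : Fin 2, ∑ q : Fin 2,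
                C p q m * pd i (comp2 p Φ) x * pd j (comp2 q Φ) x
          = ∑ l : Fin 2, A i j l * pd l (comp2 m Φ) x) := by
  rintro ⟨U, Φ, A, ⟨x, hx⟩, hU, -, hΦ, hpos, hJ, heq⟩
  have hsm : ∀ y ∈ U, ContDiffAt ℝ (⊤ : ℕ∞) Φ y := fun y hy => hΦ.contDiffAt (hU.mem_nhds hy)
  have hφ : ∀ y ∈ U, comp2 0 Φ y ≠ 0 := fun y hy => (hpos y hy).ne'
  refine no_type_A_coframe (A := A) hdet hU hx
    (e := fun i m y => pd i (comp2 m Φ) y / comp2 0 Φ y) ?_ ?_ ?_ ?_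
  · exact fun y hy i m => (((hsm y hy).comp2 m).pd).div ((hsm y hy).comp2 0) (hφ y hy)
  · intro y hy h
    have hJy := hJ y hy
    rw [det_fderiv_eq ((hsm y hy).differentiableAt (by simp))] at hJy
    have h0 := hφ y hy
    apply hJy
    field_simp at h
    linear_combination h
  · intro y hy k i m
    rw [(HasPD.div (.of_contDiffAt ((hsm y hy).comp2 m).pd)
      (.of_contDiffAt ((hsm y hy).comp2 0)) (hφ y hy)).2]
    have h := heq y hy k i m
    have h0 := hφ y hy
    change _ + (comp2 0 Φ y)⁻¹ * _ = _ at h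
    rw [← eq_sub_iff_add_eq] at h
    rw [h]
    simp only [coframeDeriv, Fin.sum_univ_two]
    field_simp
    ring
  · intro y hy k i p
    have h1 := heq y hy k i p
    have h2 := heq y hy i k p
    have h0 := hφ y hy
    change _ + (comp2 0 Φ y)⁻¹ * _ = _ at h1 h2
    rw [pd_comm ((hsm y hy).comp2 p) i k] at h2
    simp only [Fin.sum_univ_two] at h1 h2 ⊢
    field_simp at h1 h2 ⊢
    linear_combination h2 - h1
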